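/- The function u(x, y) = ½ log(1/x² + 1/y²) satisfies Δu = e^{2u} at every point of the open first quadrant T = {(x,y) ∈ ℝ² : x > 0, y > 0}, and u(p) → +∞ as p ∈ T approaches any point of ∂T. -/

import Mathlib

/-!
STATEMENT 5: The function u(x,y) = ½ log(1/x² + 1/y²) satisfies Δu = e^{2u} at every
point of the open first quadrant T = {(x,y) : x > 0, y > 0}, and u(p) → +∞ as p ∈ T
approaches any point of ∂T.
-/

open Filter Topology

/-- The Euclidean Laplacian of a function on `ℝ × ℝ`, as the sum of the two pure second
directional derivatives along the coordinate directions. -/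
noncomputable def lap2 (f : ℝ × ℝ → ℝ) (p : ℝ × ℝ) : ℝ :=
  fderiv ℝ (fun q => fderiv ℝ f q (1, 0)) p (1, 0) +
  fderiv ℝ (fun q => fderiv ℝ f q (0, 1)) p (0, 1)

/-- The open first quadrant in `ℝ²`. -/
def firstQuadrant : Set (ℝ × ℝ) := {p | 0 < p.1 ∧ 0 < p.2}

/-- The explicit solution `u(x,y) = ½ log(1/x² + 1/y²)`. -/
noncomputable def uQ (p : ℝ × ℝ) : ℝ := (1 / 2) * Real.log (1 / p.1 ^ 2 + 1 / p.2 ^ 2)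

theorem isOpen_firstQuadrant : IsOpen firstQuadrant :=
  (isOpen_lt continuous_const continuous_fst).inter (isOpen_lt continuous_const continuous_snd)

theorem uQ_eq_of_mem {q : ℝ × ℝ} (hq : q ∈ firstQuadrant) :
    uQ q = (1 / 2) * Real.log (q.1 ^ 2 + q.2 ^ 2) - Real.log q.1 - Real.log q.2 := by
  obtain ⟨hx, hy⟩ := hq
  have h : 1 / q.1 ^ 2 + 1 / q.2 ^ 2 = (q.1 ^ 2 + q.2 ^ 2) / (q.1 * q.2) ^ 2 := by
    field_simp
    ring
  rw [uQ, h, Real.log_div (by positivity) (by positivity), Real.log_pow,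
    Real.log_mul hx.ne' hy.ne']
  push_cast
  ring

theorem exp_two_mul_uQ {q : ℝ × ℝ} (hq : q ∈ firstQuadrant) :
    Real.exp (2 * uQ q) = 1 / q.1 ^ 2 + 1 / q.2 ^ 2 := by
  obtain ⟨hx, hy⟩ := hq
  have h : 2 * uQ q = Real.log (1 / q.1 ^ 2 + 1 / q.2 ^ 2) := by
    rw [uQ]
    ring
  rw [h, Real.exp_log (by positivity)]

theorem fderiv_uQ_apply {q : ℝ × ℝ} (hq : q ∈ firstQuadrant) (v : ℝ × ℝ) :
    fderiv ℝ uQ q v =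
      (q.1 * v.1 + q.2 * v.2) / (q.1 ^ 2 + q.2 ^ 2) - v.1 / q.1 - v.2 / q.2 := by
  have hev : uQ =ᶠ[𝓝 q] fun q =>
      (1 / 2) * Real.log (q.1 ^ 2 + q.2 ^ 2) - Real.log q.1 - Real.log q.2 := by
    filter_upwards [isOpen_firstQuadrant.mem_nhds hq] with r hr using uQ_eq_of_mem hr
  obtain ⟨hx, hy⟩ := hq
  have h1 : HasFDerivAt (fun q : ℝ × ℝ => q.1) (ContinuousLinearMap.fst ℝ ℝ ℝ) q := hasFDerivAt_fst
  have h2 : HasFDerivAt (fun q : ℝ × ℝ => q.2) (ContinuousLinearMap.snd ℝ ℝ ℝ) q := hasFDerivAt_snd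
  have hs : q.1 ^ 2 + q.2 ^ 2 ≠ 0 := by positivity
  have h := (((((h1.pow 2).add (h2.pow 2)).log hs).const_mul (1 / 2)).sub (h1.log hx.ne')).sub
    (h2.log hy.ne')
  rw [(h.congr_of_eventuallyEq hev).fderiv]
  simp
  field_simp

theorem fderiv_fderiv_uQ_fst {p : ℝ × ℝ} (hp : p ∈ firstQuadrant) :
    fderiv ℝ (fun q => fderiv ℝ uQ q (1, 0)) p (1, 0) =
      (p.2 ^ 2 - p.1 ^ 2) / (p.1 ^ 2 + p.2 ^ 2) ^ 2 + 1 / p.1 ^ 2 := by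
  have hev : (fun q => fderiv ℝ uQ q (1, 0)) =ᶠ[𝓝 p] fun q =>
      q.1 * (q.1 ^ 2 + q.2 ^ 2)⁻¹ - q.1⁻¹ := by
    filter_upwards [isOpen_firstQuadrant.mem_nhds hp] with r hr
    rw [fderiv_uQ_apply hr]
    simp [div_eq_mul_inv]
  obtain ⟨hx, hy⟩ := hp
  have h1 : HasFDerivAt (fun q : ℝ × ℝ => q.1) (ContinuousLinearMap.fst ℝ ℝ ℝ) p := hasFDerivAt_fst
  have h2 : HasFDerivAt (fun q : ℝ × ℝ => q.2) (ContinuousLinearMap.snd ℝ ℝ ℝ) p := hasFDerivAt_snd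
  have hs : p.1 ^ 2 + p.2 ^ 2 ≠ 0 := by positivity
  have h := (h1.mul ((hasDerivAt_inv hs).comp_hasFDerivAt p ((h1.pow 2).add (h2.pow 2)))).sub
    ((hasDerivAt_inv hx.ne').comp_hasFDerivAt p h1)
  rw [(h.congr_of_eventuallyEq hev).fderiv]
  simp
  field_simp
  ring

theorem fderiv_fderiv_uQ_snd {p : ℝ × ℝ} (hp : p ∈ firstQuadrant) :
    fderiv ℝ (fun q => fderiv ℝ uQ q (0, 1)) p (0, 1) =
      (p.1 ^ 2 - p.2 ^ 2) / (p.1 ^ 2 + p.2 ^ 2) ^ 2 + 1 / p.2 ^ 2 := by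
  have hev : (fun q => fderiv ℝ uQ q (0, 1)) =ᶠ[𝓝 p] fun q =>
      q.2 * (q.1 ^ 2 + q.2 ^ 2)⁻¹ - q.2⁻¹ := by
    filter_upwards [isOpen_firstQuadrant.mem_nhds hp] with r hr
    rw [fderiv_uQ_apply hr]
    simp [div_eq_mul_inv]
  obtain ⟨hx, hy⟩ := hp
  have h1 : HasFDerivAt (fun q : ℝ × ℝ => q.1) (ContinuousLinearMap.fst ℝ ℝ ℝ) p := hasFDerivAt_fst
  have h2 : HasFDerivAt (fun q : ℝ × ℝ => q.2) (ContinuousLinearMap.snd ℝ ℝ ℝ) p := hasFDerivAt_snd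
  have hs : p.1 ^ 2 + p.2 ^ 2 ≠ 0 := by positivity
  have h := (h2.mul ((hasDerivAt_inv hs).comp_hasFDerivAt p ((h1.pow 2).add (h2.pow 2)))).sub
    ((hasDerivAt_inv hy.ne').comp_hasFDerivAt p h2)
  rw [(h.congr_of_eventuallyEq hev).fderiv]
  simp
  field_simp
  ring

theorem neg_log_le_half_log_inv_sq_add {a b : ℝ} (ha : 0 < a) (hb : 0 ≤ b) :
    -Real.log a ≤ (1 / 2) * Real.log (1 / a ^ 2 + b) := by
  have h : Real.log (1 / a ^ 2) ≤ Real.log (1 / a ^ 2 + b) :=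
    Real.log_le_log (by positivity) (by linarith)
  rw [one_div, Real.log_inv, Real.log_pow] at h
  push_cast at h
  rw [one_div (a ^ 2)]
  linarith

theorem tendsto_neg_log_nhdsWithin {X : Type*} [TopologicalSpace X] {f : X → ℝ} {s : Set X}
    {p : X} (hf : ContinuousAt f p) (hp : f p = 0) (hs : ∀ q ∈ s, 0 < f q) :
    Tendsto (fun q => -Real.log (f q)) (𝓝[s] p) atTop := by
  refine tendsto_neg_atBot_atTop.comp (Real.tendsto_log_nhdsGT_zero.comp ?_)
  refine tendsto_nhdsWithin_iff.2 ⟨?_, eventually_mem_nhdsWithin.mono hs⟩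
  rw [← hp]
  exact hf.tendsto.mono_left nhdsWithin_le_nhds

theorem eq_zero_or_eq_zero_of_mem_frontier_firstQuadrant {p : ℝ × ℝ}
    (hp : p ∈ frontier firstQuadrant) : p.1 = 0 ∨ p.2 = 0 := by
  rw [isOpen_firstQuadrant.frontier_eq] at hp
  have hc : IsClosed {q : ℝ × ℝ | 0 ≤ q.1 ∧ 0 ≤ q.2} :=
    (isClosed_le continuous_const continuous_fst).inter
      (isClosed_le continuous_const continuous_snd)
  obtain ⟨hx, hy⟩ := closure_minimal
    (fun q (hq : q ∈ firstQuadrant) => And.intro hq.1.le hq.2.le) hc hp.1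
  by_contra! h
  exact hp.2 ⟨lt_of_le_of_ne hx h.1.symm, lt_of_le_of_ne hy h.2.symm⟩

theorem stmt_5 :
    (∀ p ∈ firstQuadrant, lap2 uQ p = Real.exp (2 * uQ p)) ∧
    (∀ p ∈ frontier firstQuadrant, Tendsto uQ (𝓝[firstQuadrant] p) atTop) := by
  refine ⟨fun p hp => ?_, fun p hp => ?_⟩
  · rw [lap2, fderiv_fderiv_uQ_fst hp, fderiv_fderiv_uQ_snd hp, exp_two_mul_uQ hp]
    ring
  · rcases eq_zero_or_eq_zero_of_mem_frontier_firstQuadrant hp with h | h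
    · refine tendsto_atTop_mono' _ ?_
        (tendsto_neg_log_nhdsWithin continuousAt_fst h fun q hq => hq.1)
      filter_upwards [self_mem_nhdsWithin] with q hq
      exact neg_log_le_half_log_inv_sq_add hq.1 (by positivity)
    · refine tendsto_atTop_mono' _ ?_
        (tendsto_neg_log_nhdsWithin continuousAt_snd h fun q hq => hq.2)
      filter_upwards [self_mem_nhdsWithin] with q hq
      rw [uQ, add_comm]
      exact neg_log_le_half_log_inv_sq_add hq.2 (by positivity)
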